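/- arXiv:2208.00727 — 5 statements merged into one kernel-verified Lean document; each statement's English description precedes it below -/
import Mathlib

section
/- Let T ≥ 3 be an integer and φ ∈ (−1, 1). Let W be a real random variable whose distribution has density f_W(w) = [Γ((T−1)/2)(1−φ) / (Γ((T−2)/2) √(π(1−φ²)))] · (1 + w²(1−φ)²/(1−φ²))^{−(T−1)/2} with respect to Lebesgue measure. Then the random variable C = W/√(1+W²) takes values in (−1, 1) and has density D(c; φ, T) = [Γ((T−1)/2)(1−φ) / (Γ((T−2)/2)√π)] · (1−c²)^{(T−4)/2} · (1−φ²)^{(T−2)/2} · (1−φ² + 2c²φ(φ−1))^{−(T−1)/2} for c ∈ (−1, 1), and density 0 outside (−1, 1). -/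
open MeasureTheory ProbabilityTheory

/-- The density `D(c; φ, T)` of the sample correlation coefficient between two orthogonal
stationary Gaussian AR(1) processes (Theorem 1). -/
noncomputable def corrDensity (T : ℕ) (φ c : ℝ) : ℝ :=
  (Real.Gamma (((T : ℝ) - 1) / 2) * (1 - φ) /
      (Real.Gamma (((T : ℝ) - 2) / 2) * Real.sqrt Real.pi)) *
    (1 - c ^ 2) ^ (((T : ℝ) - 4) / 2) *
    (1 - φ ^ 2) ^ (((T : ℝ) - 2) / 2) *
    (1 - φ ^ 2 + 2 * c ^ 2 * φ * (φ - 1)) ^ (-(((T : ℝ) - 1) / 2))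

lemma abs_div_sqrt_one_add_sq_lt_one (w : ℝ) : |w / √(1 + w ^ 2)| < 1 := by
  have h : 0 < √(1 + w ^ 2) := by positivity
  rw [abs_div, abs_of_pos h, div_lt_one h]
  exact Real.lt_sqrt_of_sq_lt (by rw [sq_abs]; linarith)

lemma one_sub_sq_pos_of_mem_Ioo {c : ℝ} (hc : c ∈ Set.Ioo (-1 : ℝ) 1) : 0 < 1 - c ^ 2 := by
  nlinarith [hc.1, hc.2]

lemma div_sqrt_one_add_sq_leftInverse {c : ℝ} (hc : c ∈ Set.Ioo (-1 : ℝ) 1) :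
    c / √(1 - c ^ 2) / √(1 + (c / √(1 - c ^ 2)) ^ 2) = c := by
  have h := one_sub_sq_pos_of_mem_Ioo hc
  have h' : 0 < √(1 - c ^ 2) := Real.sqrt_pos.2 h
  have e : 1 + (c / √(1 - c ^ 2)) ^ 2 = (1 - c ^ 2)⁻¹ := by
    rw [div_pow, Real.sq_sqrt h.le]
    field_simp
    ring
  rw [e, Real.sqrt_inv]
  field_simp

lemma div_sqrt_one_add_sq_rightInverse (w : ℝ) :
    w / √(1 + w ^ 2) / √(1 - (w / √(1 + w ^ 2)) ^ 2) = w := by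
  have h : 0 < 1 + w ^ 2 := by positivity
  have h' : 0 < √(1 + w ^ 2) := Real.sqrt_pos.2 h
  have e : 1 - (w / √(1 + w ^ 2)) ^ 2 = (1 + w ^ 2)⁻¹ := by
    rw [div_pow, Real.sq_sqrt h.le]
    field_simp
    ring
  rw [e, Real.sqrt_inv]
  field_simp

lemma hasDerivAt_div_sqrt_one_sub_sq {c : ℝ} (hc : c ∈ Set.Ioo (-1 : ℝ) 1) :
    HasDerivAt (fun c : ℝ => c / √(1 - c ^ 2)) ((1 - c ^ 2) * √(1 - c ^ 2))⁻¹ c := by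
  have h := one_sub_sq_pos_of_mem_Ioo hc
  have h' : 0 < √(1 - c ^ 2) := Real.sqrt_pos.2 h
  have hs : HasDerivAt (fun c : ℝ => √(1 - c ^ 2)) (-(2 * c) / (2 * √(1 - c ^ 2))) c := by
    have := ((hasDerivAt_pow 2 c).const_sub 1).sqrt h.ne'
    simpa using this
  refine ((hasDerivAt_id' c).div hs h'.ne').congr_deriv ?_
  have e := Real.sq_sqrt h.le
  have e' : 1 * √(1 - c ^ 2) - c * (-(2 * c) / (2 * √(1 - c ^ 2))) = (√(1 - c ^ 2))⁻¹ := by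
    field_simp
    rw [e]
    ring
  rw [e', e, mul_inv, div_eq_mul_inv, mul_comm]

/-- The law of `w / √(1 + w ^ 2)` when `w` has density `f`. -/
lemma map_div_sqrt_one_add_sq_withDensity (f : ℝ → ENNReal) :
    (volume.withDensity f).map (fun w : ℝ => w / √(1 + w ^ 2)) =
      volume.withDensity ((Set.Ioo (-1 : ℝ) 1).indicator fun c =>
        ENNReal.ofReal ((1 - c ^ 2) * √(1 - c ^ 2))⁻¹ * f (c / √(1 - c ^ 2))) := by
  have hm : Measurable (fun w : ℝ => w / √(1 + w ^ 2)) := by fun_prop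
  ext s hs
  have himage : (fun w : ℝ => w / √(1 + w ^ 2)) ⁻¹' s =
      (fun c : ℝ => c / √(1 - c ^ 2)) '' (s ∩ Set.Ioo (-1) 1) := by
    ext w
    constructor
    · intro hw
      exact ⟨w / √(1 + w ^ 2), ⟨hw, abs_lt.1 (abs_div_sqrt_one_add_sq_lt_one w)⟩,
        div_sqrt_one_add_sq_rightInverse w⟩
    · rintro ⟨c, ⟨hcs, hc⟩, rfl⟩
      simpa only [Set.mem_preimage, div_sqrt_one_add_sq_leftInverse hc] using hcs
  have hinj : Set.InjOn (fun c : ℝ => c / √(1 - c ^ 2)) (s ∩ Set.Ioo (-1) 1) := by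
    intro a ha b hb hab
    have hab : a / √(1 - a ^ 2) = b / √(1 - b ^ 2) := hab
    rw [← div_sqrt_one_add_sq_leftInverse ha.2, hab, div_sqrt_one_add_sq_leftInverse hb.2]
  rw [Measure.map_apply hm hs, withDensity_apply _ (hm hs), withDensity_apply _ hs, himage,
    lintegral_image_eq_lintegral_abs_deriv_mul (hs.inter measurableSet_Ioo)
      (fun c hc => (hasDerivAt_div_sqrt_one_sub_sq hc.2).hasDerivWithinAt) hinj,
    setLIntegral_indicator measurableSet_Ioo, Set.inter_comm]
  refine setLIntegral_congr_fun (measurableSet_Ioo.inter hs) fun c hc => ?_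
  have h := one_sub_sq_pos_of_mem_Ioo hc.1
  rw [abs_of_nonneg (by positivity)]

lemma jacobian_mul_density_eq_corrDensity (T : ℕ) {φ c : ℝ} (hφ : φ ∈ Set.Ioo (-1 : ℝ) 1)
    (hc : c ∈ Set.Ioo (-1 : ℝ) 1) :
    ((1 - c ^ 2) * √(1 - c ^ 2))⁻¹ *
      ((Real.Gamma (((T : ℝ) - 1) / 2) * (1 - φ) /
          (Real.Gamma (((T : ℝ) - 2) / 2) * Real.sqrt (Real.pi * (1 - φ ^ 2)))) *
        (1 + (c / √(1 - c ^ 2)) ^ 2 * (1 - φ) ^ 2 / (1 - φ ^ 2)) ^ (-(((T : ℝ) - 1) / 2))) =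
      corrDensity T φ c := by
  have ha := one_sub_sq_pos_of_mem_Ioo hc
  have hb := one_sub_sq_pos_of_mem_Ioo hφ
  have hn : 1 - φ ^ 2 + 2 * c ^ 2 * φ * (φ - 1) =
      (1 - c ^ 2) * (1 - φ ^ 2) + c ^ 2 * (1 - φ) ^ 2 := by ring
  have hnpos : 0 < 1 - φ ^ 2 + 2 * c ^ 2 * φ * (φ - 1) := by rw [hn]; positivity
  have e : 1 + (c / √(1 - c ^ 2)) ^ 2 * (1 - φ) ^ 2 / (1 - φ ^ 2) =
      (1 - φ ^ 2 + 2 * c ^ 2 * φ * (φ - 1)) / ((1 - c ^ 2) * (1 - φ ^ 2)) := by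
    rw [hn, div_pow, Real.sq_sqrt ha.le]
    field_simp
  have e1 : (1 - c ^ 2) ^ (((T : ℝ) - 4) / 2) =
      (1 - c ^ 2) ^ (((T : ℝ) - 1) / 2) / ((1 - c ^ 2) * √(1 - c ^ 2)) := by
    rw [show ((T : ℝ) - 4) / 2 = ((T : ℝ) - 1) / 2 - (1 + 1 / 2) by ring, Real.rpow_sub ha,
      Real.rpow_add ha, Real.rpow_one, Real.sqrt_eq_rpow]
  have e2 : (1 - φ ^ 2) ^ (((T : ℝ) - 2) / 2) =
      (1 - φ ^ 2) ^ (((T : ℝ) - 1) / 2) / √(1 - φ ^ 2) := by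
    rw [show ((T : ℝ) - 2) / 2 = ((T : ℝ) - 1) / 2 - 1 / 2 by ring, Real.rpow_sub hb,
      Real.sqrt_eq_rpow]
  rw [corrDensity, e, e1, e2, Real.sqrt_mul Real.pi_pos.le, Real.rpow_neg (by positivity),
    Real.div_rpow hnpos.le (by positivity), Real.mul_rpow ha.le hb.le, Real.rpow_neg hnpos.le]
  simp only [div_eq_mul_inv, mul_inv, inv_inv]
  ring

/-- the change-of-variables step in the proof of Theorem 1, transferring the
density of the t-type statistic `W` to the sample correlation `C = W/√(1+W²)`. -/
theorem correlation_change_of_variables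
    {Ω : Type*} [MeasurableSpace Ω] (P : Measure Ω) [IsProbabilityMeasure P]
    (T : ℕ) (hT : 3 ≤ T)
    (φ : ℝ) (hφ : φ ∈ Set.Ioo (-1 : ℝ) 1)
    (W : Ω → ℝ)
    (hW : Measure.map W P = volume.withDensity (fun w => ENNReal.ofReal
      ((Real.Gamma (((T : ℝ) - 1) / 2) * (1 - φ) /
          (Real.Gamma (((T : ℝ) - 2) / 2) * Real.sqrt (Real.pi * (1 - φ ^ 2)))) *
        (1 + w ^ 2 * (1 - φ) ^ 2 / (1 - φ ^ 2)) ^ (-(((T : ℝ) - 1) / 2)))))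
    (C : Ω → ℝ) (hC : C = fun ω => W ω / Real.sqrt (1 + W ω ^ 2)) :
    (∀ ω, C ω ∈ Set.Ioo (-1 : ℝ) 1) ∧
      Measure.map C P = volume.withDensity (fun c =>
        if c ∈ Set.Ioo (-1 : ℝ) 1 then ENNReal.ofReal (corrDensity T φ c) else 0) := by
  have hWm : AEMeasurable W P := by
    by_contra h
    rw [Measure.map_of_not_aemeasurable h, eq_comm, withDensity_eq_zero_iff
      (by fun_prop)] at hW
    have hb := one_sub_sq_pos_of_mem_Ioo hφ
    have hT' : (3 : ℝ) ≤ T := by exact_mod_cast hT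
    have h1 : 0 < Real.Gamma (((T : ℝ) - 1) / 2) := Real.Gamma_pos_of_pos (by linarith)
    have h2 : 0 < Real.Gamma (((T : ℝ) - 2) / 2) := Real.Gamma_pos_of_pos (by linarith)
    have h3 : 0 < 1 - φ := by linarith [hφ.2]
    obtain ⟨w, hw⟩ := hW.exists
    exact (ENNReal.ofReal_pos.2 (by positivity)).ne' hw
  subst hC
  refine ⟨fun ω => abs_lt.1 (abs_div_sqrt_one_add_sq_lt_one (W ω)), ?_⟩
  have hm : Measurable (fun w : ℝ => w / √(1 + w ^ 2)) := by fun_prop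
  rw [← Function.comp_def (fun w : ℝ => w / √(1 + w ^ 2)) W,
    ← AEMeasurable.map_map_of_aemeasurable hm.aemeasurable hWm, hW,
    map_div_sqrt_one_add_sq_withDensity]
  congr 1
  ext c
  by_cases hc : c ∈ Set.Ioo (-1 : ℝ) 1
  · have h := one_sub_sq_pos_of_mem_Ioo hc
    rw [Set.indicator_of_mem hc, if_pos hc, ← ENNReal.ofReal_mul (by positivity),
      jacobian_mul_density_eq_corrDensity T hφ hc]
  · rw [Set.indicator_of_notMem hc, if_neg hc]
end

section
/- Let T ≥ 3 be an integer, φ₁, φ₂ ∈ (−1, 1), and set φ₁₂ = φ₁φ₂, δ² = (1−φ₁²φ₂²)/((1−φ₂²)(1−φ₁φ₂)²), θ² = 1/(1−φ₂²). Let X and V be independent random variables with X distributed as N(0, δ²) and V distributed as Gamma with shape (T−2)/2 and rate 1/(2θ²). Then the random variable C = X/√(X² + V) takes values in (−1, 1) and its distribution has density D(c; φ₁₂, T) = [Γ((T−1)/2)(1−φ₁₂)/(Γ((T−2)/2)√π)] · (1−c²)^{(T−4)/2} · (1−φ₁₂²)^{(T−2)/2} · (1−φ₁₂² + 2c²φ₁₂(φ₁₂−1))^{−(T−1)/2}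 with respect to Lebesgue measure on (−1, 1), and density 0 outside (−1, 1). -/
open MeasureTheory ProbabilityTheory

/-- `c ↦ c √v / √(1 - c²)` is inverted on `(-1, 1)` by `x ↦ x / √(x² + v)`. -/
lemma div_sqrt_sq_add_leftInverse {v c : ℝ} (hv : 0 < v) (hc : c ∈ Set.Ioo (-1 : ℝ) 1) :
    (c * √v / √(1 - c ^ 2)) / √((c * √v / √(1 - c ^ 2)) ^ 2 + v) = c := by
  have hy : 0 < 1 - c ^ 2 := by nlinarith [hc.1, hc.2]
  have h : (c * √v / √(1 - c ^ 2)) ^ 2 + v = v / (1 - c ^ 2) := by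
    rw [div_pow, mul_pow, Real.sq_sqrt hv.le, Real.sq_sqrt hy.le]
    field_simp
    ring
  have h1 := Real.sqrt_pos.2 hv
  have h2 := Real.sqrt_pos.2 hy
  rw [h, Real.sqrt_div hv.le]
  field_simp

lemma image_mul_sqrt_div_sqrt {v : ℝ} (hv : 0 < v) :
    (fun c : ℝ => c * √v / √(1 - c ^ 2)) '' Set.Ioo (-1) 1 = Set.univ := by
  refine Set.eq_univ_of_forall fun x => ?_
  have hw : 0 < x ^ 2 + v := by positivity
  have hsw := Real.sqrt_pos.2 hw
  have hlt : |x| < √(x ^ 2 + v) := by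
    rw [← Real.sqrt_sq_eq_abs]
    exact Real.sqrt_lt_sqrt (sq_nonneg x) (by linarith)
  refine ⟨x / √(x ^ 2 + v), ?_, ?_⟩
  · rw [Set.mem_Ioo, ← abs_lt, abs_div, abs_of_pos hsw, div_lt_one hsw]
    exact hlt
  · have h : 1 - (x / √(x ^ 2 + v)) ^ 2 = v / (x ^ 2 + v) := by
      rw [div_pow, Real.sq_sqrt hw.le]
      field_simp
      ring
    have h1 := Real.sqrt_pos.2 hv
    simp only [h, Real.sqrt_div hv.le]
    field_simp

lemma hasDerivAt_mul_sqrt_div_sqrt (v : ℝ) {c : ℝ} (hc : c ∈ Set.Ioo (-1 : ℝ) 1) :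
    HasDerivAt (fun c : ℝ => c * √v / √(1 - c ^ 2)) (√v / √(1 - c ^ 2) ^ 3) c := by
  have hy : 0 < 1 - c ^ 2 := by nlinarith [hc.1, hc.2]
  have h2 := Real.sqrt_pos.2 hy
  have hs := Real.sq_sqrt hy.le
  have h := ((hasDerivAt_id c).mul_const √v).div
    ((((hasDerivAt_id c).pow 2).const_sub 1).sqrt hy.ne') h2.ne'
  refine h.congr_deriv ?_
  simp only [id, Pi.pow_apply]
  field_simp
  norm_num
  left
  linear_combination 2 * hs

/-- For fixed `v > 0`, the law of `X / √(X² + v)` for a centered Gaussian `X`. -/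
lemma gaussianReal_div_sqrt_sq_add_preimage {s : NNReal} (hs : s ≠ 0) {v : ℝ} (hv : 0 < v)
    {A : Set ℝ} (hA : MeasurableSet A) :
    gaussianReal 0 s ((fun x => x / √(x ^ 2 + v)) ⁻¹' A) =
      ∫⁻ c in Set.Ioo (-1 : ℝ) 1 ∩ A, ENNReal.ofReal (√v / √(1 - c ^ 2) ^ 3) *
          gaussianPDF 0 s (c * √v / √(1 - c ^ 2)) := by
  have hB : MeasurableSet ((fun x : ℝ => x / √(x ^ 2 + v)) ⁻¹' A) :=
    (by fun_prop : Measurable fun x : ℝ => x / √(x ^ 2 + v)) hA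
  rw [gaussianReal_apply _ hs, ← lintegral_indicator hB, ← setLIntegral_univ,
    ← image_mul_sqrt_div_sqrt hv,
    lintegral_image_eq_lintegral_abs_deriv_mul measurableSet_Ioo
      (fun c hc => (hasDerivAt_mul_sqrt_div_sqrt v hc).hasDerivWithinAt)
      (Set.LeftInvOn.injOn (f₁' := fun x => x / √(x ^ 2 + v))
        fun c hc => div_sqrt_sq_add_leftInverse hv hc),
    Set.inter_comm, ← Measure.restrict_restrict hA, ← lintegral_indicator hA]
  refine setLIntegral_congr_fun measurableSet_Ioo fun c hc => ?_
  have hiff : c * √v / √(1 - c ^ 2) ∈ (fun x : ℝ => x / √(x ^ 2 + v)) ⁻¹' A ↔ c ∈ A := by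
    rw [Set.mem_preimage, div_sqrt_sq_add_leftInverse hv hc]
  by_cases hcA : c ∈ A
  · simp only [Set.indicator_of_mem (hiff.2 hcA), Set.indicator_of_mem hcA]
    rw [abs_of_nonneg (by positivity)]
  · simp only [Set.indicator_of_notMem (mt hiff.1 hcA), Set.indicator_of_notMem hcA, mul_zero]

/-- The `1/2`-moment of a Gamma law, tilted by an exponential. -/
lemma lintegral_gammaPDF_mul_sqrt_mul_exp {a r b : ℝ} (ha : 0 < a) (hr : 0 < r) (hb : 0 ≤ b) :
    ∫⁻ v, gammaPDF a r v * ENNReal.ofReal (√v * Real.exp (-(b * v))) =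
      ENNReal.ofReal (r ^ a / Real.Gamma a * (Real.Gamma (a + 1 / 2) / (r + b) ^ (a + 1 / 2))) := by
  have hrb : 0 < r + b := by linarith
  have hG := Real.Gamma_pos_of_pos ha
  have hG' := Real.Gamma_pos_of_pos (by linarith : 0 < a + 1 / 2)
  have hp : 0 < (r + b) ^ (a + 1 / 2) := by positivity
  calc _ = ∫⁻ v, ENNReal.ofReal (r ^ a / Real.Gamma a *
        (Real.Gamma (a + 1 / 2) / (r + b) ^ (a + 1 / 2))) * gammaPDF (a + 1 / 2) (r + b) v := by
        have h0 : ∀ᵐ v : ℝ, v ≠ 0 := by simp [ae_iff]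
        refine lintegral_congr_ae ?_
        filter_upwards [h0] with v hv0
        rcases hv0.lt_or_gt with hv | hv
        · simp [gammaPDF_of_neg hv]
        · rw [gammaPDF_of_nonneg hv.le, gammaPDF_of_nonneg hv.le,
            ← ENNReal.ofReal_mul (by positivity), ← ENNReal.ofReal_mul (by positivity)]
          congr 1
          have e1 : v ^ (a + 1 / 2 - 1) = v ^ (a - 1) * √v := by
            rw [Real.sqrt_eq_rpow, ← Real.rpow_add hv]
            ring_nf
          have e2 : Real.exp (-((r + b) * v)) = Real.exp (-(r * v)) * Real.exp (-(b * v)) := by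
            rw [← Real.exp_add]
            ring_nf
          rw [e1, e2]
          field_simp
    _ = _ := by
        rw [lintegral_const_mul' _ _ ENNReal.ofReal_ne_top,
          lintegral_gammaPDF_eq_one (by linarith) hrb, mul_one]

/-- The density of `X / √(X² + V)` for `X` a centered Gaussian and `V` an independent Gamma. -/
lemma map_div_sqrt_sq_add_gaussianReal_prod_gammaMeasure {s : NNReal} (hs : s ≠ 0) {a r : ℝ}
    (ha : 0 < a) (hr : 0 < r) :
    Measure.map (fun p : ℝ × ℝ => p.1 / √(p.1 ^ 2 + p.2))
        ((gaussianReal 0 s).prod (gammaMeasure a r)) =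
      (volume.restrict (Set.Ioo (-1 : ℝ) 1)).withDensity fun c =>
        ENNReal.ofReal ((√(1 - c ^ 2) ^ 3)⁻¹ * (√(2 * Real.pi * s))⁻¹ *
          (r ^ a / Real.Gamma a * (Real.Gamma (a + 1 / 2) /
            (r + c ^ 2 / (2 * s * (1 - c ^ 2))) ^ (a + 1 / 2)))) := by
  have := isProbabilityMeasure_gammaMeasure ha hr
  have hm : Measurable fun p : ℝ × ℝ => p.1 / √(p.1 ^ 2 + p.2) := by fun_prop
  have hmγ : Measurable (gammaPDF a r) := (measurable_gammaPDFReal a r).ennreal_ofReal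
  have hmg : Measurable (gaussianPDF 0 s) := measurable_gaussianPDF 0 s
  ext A hA
  rw [Measure.map_apply hm hA, Measure.prod_apply_symm (hm hA), gammaMeasure,
    lintegral_withDensity_eq_lintegral_mul _ hmγ (measurable_measure_prodMk_right (hm hA)),
    withDensity_apply _ hA, Measure.restrict_restrict hA, Set.inter_comm A]
  calc _ = ∫⁻ v, ∫⁻ c in Set.Ioo (-1 : ℝ) 1 ∩ A, gammaPDF a r v *
        (ENNReal.ofReal (√v / √(1 - c ^ 2) ^ 3) *
          gaussianPDF 0 s (c * √v / √(1 - c ^ 2))) := by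
        have h0 : ∀ᵐ v : ℝ, v ≠ 0 := by simp [ae_iff]
        refine lintegral_congr_ae ?_
        filter_upwards [h0] with v hv0
        rcases hv0.lt_or_gt with hv | hv
        · simp [gammaPDF_of_neg hv]
        · rw [lintegral_const_mul' (gammaPDF a r v) _ ENNReal.ofReal_ne_top,
            ← gaussianReal_div_sqrt_sq_add_preimage hs hv hA]
          rfl
    _ = ∫⁻ c in Set.Ioo (-1 : ℝ) 1 ∩ A, ∫⁻ v, gammaPDF a r v *
        (ENNReal.ofReal (√v / √(1 - c ^ 2) ^ 3) *
          gaussianPDF 0 s (c * √v / √(1 - c ^ 2))) := by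
        refine lintegral_lintegral_swap (Measurable.aemeasurable ?_)
        simp only [Function.uncurry_def]
        fun_prop
    _ = _ := by
        refine setLIntegral_congr_fun (measurableSet_Ioo.inter hA) fun c hc => ?_
        have hy : 0 < 1 - c ^ 2 := by nlinarith [hc.1.1, hc.1.2]
        have hs' : (0 : ℝ) < s := by positivity
        have hb : 0 ≤ c ^ 2 / (2 * s * (1 - c ^ 2)) := by positivity
        rw [ENNReal.ofReal_mul (by positivity),
          ← lintegral_gammaPDF_mul_sqrt_mul_exp ha hr hb,
          ← lintegral_const_mul' _ _ ENNReal.ofReal_ne_top]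
        refine lintegral_congr fun v => ?_
        rcases lt_or_ge v 0 with hv | hv
        · simp [gammaPDF_of_neg hv]
        rw [mul_left_comm (ENNReal.ofReal _)]
        congr 1
        rw [gaussianPDF, gaussianPDFReal, ← ENNReal.ofReal_mul (by positivity),
          ← ENNReal.ofReal_mul (by positivity)]
        congr 1
        have e : -(c * √v / √(1 - c ^ 2) - 0) ^ 2 / (2 * (s : ℝ)) =
            -(c ^ 2 / (2 * s * (1 - c ^ 2)) * v) := by
          rw [sub_zero, div_pow, mul_pow, Real.sq_sqrt hv, Real.sq_sqrt hy.le]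
          field_simp
        rw [e]
        ring

lemma corrDensity_eq_gaussian_gamma_mixture {T : ℕ} (hT : 3 ≤ T) {φ c r d : ℝ}
    (hφ : φ ∈ Set.Ioo (-1 : ℝ) 1) (hc : c ∈ Set.Ioo (-1 : ℝ) 1) (hr : 0 < r)
    (hd : 2 * d * (r * (1 - φ) ^ 2) = 1 - φ ^ 2) :
    (√(1 - c ^ 2) ^ 3)⁻¹ * (√(2 * Real.pi * d))⁻¹ *
          (r ^ (((T : ℝ) - 2) / 2) / Real.Gamma (((T : ℝ) - 2) / 2) *
            (Real.Gamma (((T : ℝ) - 2) / 2 + 1 / 2) /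
            (r + c ^ 2 / (2 * d * (1 - c ^ 2))) ^ (((T : ℝ) - 2) / 2 + 1 / 2))) =
      corrDensity T φ c := by
  obtain ⟨hφ1, hφ2⟩ := hφ
  have hT' : (3 : ℝ) ≤ T := by exact_mod_cast hT
  have hy : 0 < 1 - c ^ 2 := by nlinarith [hc.1, hc.2]
  have hw : 0 < 1 - φ ^ 2 := by nlinarith
  have hm : 0 < 1 - φ := by linarith
  have hQ : 0 < 1 - φ ^ 2 + 2 * c ^ 2 * φ * (φ - 1) := by
    have : 1 - φ ^ 2 + 2 * c ^ 2 * φ * (φ - 1) =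
      (1 - φ) * ((1 - c ^ 2) * (1 + φ) + c ^ 2 * (1 - φ)) := by ring
    rw [this]
    have : 0 < (1 - c ^ 2) * (1 + φ) := mul_pos hy (by linarith)
    positivity
  have hd' : d = (1 - φ ^ 2) / (2 * (r * (1 - φ) ^ 2)) := by
    field_simp
    linarith
  have e1 : r + c ^ 2 / (2 * d * (1 - c ^ 2)) =
      r * (1 - φ ^ 2 + 2 * c ^ 2 * φ * (φ - 1)) / ((1 - φ ^ 2) * (1 - c ^ 2)) := by
    rw [hd']
    field_simp
    ring
  have e2 : √(2 * Real.pi * d) = √Real.pi * √(1 - φ ^ 2) / (√r * (1 - φ)) := by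
    rw [hd', show 2 * Real.pi * ((1 - φ ^ 2) / (2 * (r * (1 - φ) ^ 2))) =
      Real.pi * (1 - φ ^ 2) / (r * (1 - φ) ^ 2) by field_simp, Real.sqrt_div (by positivity),
      Real.sqrt_mul Real.pi_pos.le, Real.sqrt_mul hr.le, Real.sqrt_sq hm.le]
  have hy4 : (1 - c ^ 2) ^ (((T : ℝ) - 2) / 2 + 1 / 2) =
      (1 - c ^ 2) ^ (((T : ℝ) - 4) / 2) * √(1 - c ^ 2) ^ 3 := by
    rw [Real.sqrt_eq_rpow, ← Real.rpow_natCast ((1 - c ^ 2) ^ (1 / 2 : ℝ)) 3, ← Real.rpow_mul hy.le,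
      ← Real.rpow_add hy]
    push_cast
    ring_nf
  rw [corrDensity, e1, e2, Real.rpow_neg hQ.le, show ((T : ℝ) - 1) / 2 = (T - 2) / 2 + 1 / 2 by ring,
    Real.div_rpow (by positivity) (by positivity), Real.mul_rpow hr.le hQ.le,
    Real.mul_rpow hw.le hy.le, hy4, Real.rpow_add hr, Real.rpow_add hw, ← Real.sqrt_eq_rpow,
    ← Real.sqrt_eq_rpow]
  have hG := Real.Gamma_pos_of_pos (by linarith : 0 < ((T : ℝ) - 2) / 2)
  have h1 := Real.sqrt_pos.2 hr
  have h2 := Real.sqrt_pos.2 hw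
  have h3 := Real.sqrt_pos.2 hy
  have h4 := Real.rpow_pos_of_pos hr (((T : ℝ) - 2) / 2)
  have h5 := Real.rpow_pos_of_pos hQ (((T : ℝ) - 2) / 2 + 1 / 2)
  have h6 := Real.sqrt_pos.2 Real.pi_pos
  generalize r ^ (((T : ℝ) - 2) / 2) = R at *
  generalize (1 - φ ^ 2 + 2 * c ^ 2 * φ * (φ - 1)) ^ (((T : ℝ) - 2) / 2 + 1 / 2) = Q at *
  generalize (1 - c ^ 2) ^ (((T : ℝ) - 4) / 2) = Y at *
  generalize (1 - φ ^ 2) ^ (((T : ℝ) - 2) / 2) = W at *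
  field_simp

/-- exact version of Theorem 1: if `X ~ N(0, δ²)` and
`V ~ Gamma((T-2)/2, 1/(2θ²))` are independent, with `δ², θ²` as determined by the
autoregressive coefficients `φ₁, φ₂`, then `C = X/√(X²+V)` takes values in `(-1, 1)` and
has density `D(·; φ₁φ₂, T)` there. -/
theorem sample_correlation_density
    {Ω : Type*} [MeasurableSpace Ω] (P : Measure Ω) [IsProbabilityMeasure P]
    (T : ℕ) (hT : 3 ≤ T)
    (φ₁ φ₂ : ℝ) (hφ₁ : φ₁ ∈ Set.Ioo (-1 : ℝ) 1) (hφ₂ : φ₂ ∈ Set.Ioo (-1 : ℝ) 1)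
    (φ₁₂ : ℝ) (hφ₁₂ : φ₁₂ = φ₁ * φ₂)
    (δsq θsq : ℝ)
    (hδsq : δsq = (1 - φ₁ ^ 2 * φ₂ ^ 2) / ((1 - φ₂ ^ 2) * (1 - φ₁ * φ₂) ^ 2))
    (hθsq : θsq = 1 / (1 - φ₂ ^ 2))
    (X V : Ω → ℝ) (hmX : Measurable X) (hmV : Measurable V)
    (hindep : IndepFun X V P)
    (hX : Measure.map X P = gaussianReal 0 δsq.toNNReal)
    (hV : Measure.map V P = gammaMeasure (((T : ℝ) - 2) / 2) (1 / (2 * θsq)))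
    (C : Ω → ℝ) (hC : C = fun ω => X ω / Real.sqrt (X ω ^ 2 + V ω)) :
    (∀ᵐ ω ∂P, C ω ∈ Set.Ioo (-1 : ℝ) 1) ∧
      Measure.map C P = volume.withDensity (fun c =>
        if c ∈ Set.Ioo (-1 : ℝ) 1 then ENNReal.ofReal (corrDensity T φ₁₂ c) else 0) := by
  obtain ⟨hl₁, hu₁⟩ := hφ₁
  obtain ⟨hl₂, hu₂⟩ := hφ₂
  have hT' : (3 : ℝ) ≤ T := by exact_mod_cast hT
  have ha : 0 < ((T : ℝ) - 2) / 2 := by linarith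
  have hφ : φ₁₂ ∈ Set.Ioo (-1 : ℝ) 1 := by
    rw [hφ₁₂, Set.mem_Ioo, ← abs_lt, abs_mul]
    exact mul_lt_one_of_nonneg_of_lt_one_left (abs_nonneg _) (abs_lt.2 ⟨hl₁, hu₁⟩)
      (abs_lt.2 ⟨hl₂, hu₂⟩).le
  have hw₂ : 0 < 1 - φ₂ ^ 2 := by nlinarith
  have hw : 0 < 1 - φ₁₂ ^ 2 := by nlinarith [hφ.1, hφ.2]
  have hm : 0 < 1 - φ₁₂ := by linarith [hφ.2]
  rw [← mul_pow, ← hφ₁₂] at hδsq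
  have hδ : 0 < δsq := by rw [hδsq]; positivity
  have hr : 0 < 1 / (2 * θsq) := by rw [hθsq]; positivity
  have hs : δsq.toNNReal ≠ 0 := (Real.toNNReal_pos.2 hδ).ne'
  have hd : 2 * δsq * (1 / (2 * θsq) * (1 - φ₁₂) ^ 2) = 1 - φ₁₂ ^ 2 := by
    rw [hδsq, hθsq]
    field_simp
  have hmC : Measurable C := by
    rw [hC]
    fun_prop
  have hlaw : Measure.map C P = volume.withDensity (fun c =>
      if c ∈ Set.Ioo (-1 : ℝ) 1 then ENNReal.ofReal (corrDensity T φ₁₂ c) else 0) := by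
    have hprod := (indepFun_iff_map_prod_eq_prod_map_map hmX.aemeasurable hmV.aemeasurable).1 hindep
    rw [hX, hV] at hprod
    have hcomp : Measure.map C P = Measure.map (fun p : ℝ × ℝ => p.1 / √(p.1 ^ 2 + p.2))
        (Measure.map (fun ω => (X ω, V ω)) P) := by
      rw [Measure.map_map (by fun_prop) (by fun_prop), hC]
      rfl
    rw [hcomp, hprod, map_div_sqrt_sq_add_gaussianReal_prod_gammaMeasure hs ha hr,
      ← withDensity_indicator measurableSet_Ioo]
    congr 1
    ext c
    by_cases hc : c ∈ Set.Ioo (-1 : ℝ) 1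
    · rw [Set.indicator_of_mem hc, if_pos hc, Real.coe_toNNReal _ hδ.le,
        corrDensity_eq_gaussian_gamma_mixture hT hφ hc hr hd]
    · rw [Set.indicator_of_notMem hc, if_neg hc]
  refine ⟨?_, hlaw⟩
  refine ae_of_ae_map hmC.aemeasurable ?_
  rw [hlaw, ae_iff]
  change volume.withDensity _ (Set.Ioo (-1 : ℝ) 1)ᶜ = 0
  rw [withDensity_apply _ measurableSet_Ioo.compl,
    setLIntegral_congr_fun measurableSet_Ioo.compl (fun c hc => if_neg hc), lintegral_zero]
end

section
/- Let T ≥ 3 be an integer and φ ∈ (−1, 1). Then ∫_{−1}^{1} D(c; φ, T) dc = 1, where D(c; φ, T) = [Γ((T−1)/2)(1−φ)/(Γ((T−2)/2)√π)] · (1−c²)^{(T−4)/2} · (1−φ²)^{(T−2)/2} · (1−φ² + 2c²φ(φ−1))^{−(T−1)/2}. -/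
open MeasureTheory

/-- The symmetric beta integral on `(0, 1)`. -/
lemma integral_rpow_mul_one_sub_rpow {a : ℝ} (ha : 0 < a) :
    ∫ x in (0 : ℝ)..1, (x * (1 - x)) ^ (a - 1) =
      Real.Gamma a * Real.Gamma a / Real.Gamma (2 * a) := by
  have h := Complex.betaIntegral_eq_Gamma_mul_div (a : ℂ) (a : ℂ) (by simpa) (by simpa)
  rw [Complex.betaIntegral, ← two_mul] at h
  rw [← Complex.ofReal_inj, ← intervalIntegral.integral_ofReal]
  push_cast [← Complex.Gamma_ofReal]
  rw [← h]
  refine intervalIntegral.integral_congr fun x hx => ?_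
  rw [Set.uIcc_of_le zero_le_one] at hx
  have h1 : 0 ≤ 1 - x := sub_nonneg.2 hx.2
  simp only [Real.mul_rpow hx.1 h1]
  push_cast [Complex.ofReal_cpow hx.1, Complex.ofReal_cpow h1]
  rfl

/-- The normalizing constant of the weight `(1 - u ^ 2) ^ (a - 1)` on `(-1, 1)`. -/
lemma integral_one_sub_sq_rpow {a : ℝ} (ha : 0 < a) :
    ∫ u in (-1 : ℝ)..1, (1 - u ^ 2) ^ (a - 1) =
      Real.Gamma a * √Real.pi / Real.Gamma (a + 1 / 2) := by
  have hsub := intervalIntegral.integral_comp_mul_sub (a := 0) (b := 1)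
    (fun u : ℝ => (1 - u ^ 2) ^ (a - 1)) (two_ne_zero' ℝ) 1
  norm_num at hsub
  have hscale : ∫ x in (0 : ℝ)..1, (1 - (2 * x - 1) ^ 2) ^ (a - 1) =
      4 ^ (a - 1) * ∫ x in (0 : ℝ)..1, (x * (1 - x)) ^ (a - 1) := by
    rw [← intervalIntegral.integral_const_mul]
    refine intervalIntegral.integral_congr fun x hx => ?_
    rw [Set.uIcc_of_le zero_le_one] at hx
    have h1 : 0 ≤ x * (1 - x) := mul_nonneg hx.1 (sub_nonneg.2 hx.2)
    rw [← Real.mul_rpow (by norm_num) h1]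
    ring_nf
  rw [hscale, integral_rpow_mul_one_sub_rpow ha] at hsub
  have hdup := Real.Gamma_mul_Gamma_add_half a
  have hG2 := (Real.Gamma_pos_of_pos (by positivity : 0 < 2 * a)).ne'
  have hGh := (Real.Gamma_pos_of_pos (by positivity : 0 < a + 1 / 2)).ne'
  have hpow : (2 : ℝ) * 4 ^ (a - 1) * 2 ^ (1 - 2 * a) = 1 := by
    rw [show (4 : ℝ) = 2 ^ (2 : ℝ) by norm_num, ← Real.rpow_mul zero_le_two]
    nth_rewrite 1 [← Real.rpow_one 2]
    rw [← Real.rpow_add two_pos, ← Real.rpow_add two_pos]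
    ring_nf
    simp
  have hval : ∫ u in (-1 : ℝ)..1, (1 - u ^ 2) ^ (a - 1) =
      2 * 4 ^ (a - 1) * (Real.Gamma a * Real.Gamma a / Real.Gamma (2 * a)) := by
    linarith
  rw [hval, eq_div_iff hGh, mul_div_assoc', div_mul_eq_mul_div, div_eq_iff hG2]
  linear_combination (2 * 4 ^ (a - 1) * Real.Gamma a) * hdup +
    Real.Gamma a * Real.Gamma (2 * a) * √Real.pi * hpow

/-- The change of variables `u = k * c / √(A - B * c ^ 2)` on `(-1, 1)`, where
`k ^ 2 = A - B`. -/
lemma integral_comp_mul_div_sqrt {A k : ℝ} (hA : 0 < A) (hk : 0 < k) (f : ℝ → ℝ) :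
    ∫ u in (-1 : ℝ)..1, f u = ∫ c in (-1 : ℝ)..1,
      k * A / (√(A - (A - k ^ 2) * c ^ 2)) ^ 3 * f (k * c / √(A - (A - k ^ 2) * c ^ 2)) := by
  have hpos : ∀ c ∈ Set.Icc (-1 : ℝ) 1, 0 < A - (A - k ^ 2) * c ^ 2 := by
    rintro c ⟨h1, h2⟩
    have hc : 0 ≤ 1 - c ^ 2 := by nlinarith
    rcases eq_or_ne c 0 with rfl | h0
    · simpa
    · have : A - (A - k ^ 2) * c ^ 2 = A * (1 - c ^ 2) + k ^ 2 * c ^ 2 := by ring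
      rw [this]
      positivity
  set g : ℝ → ℝ := fun c => k * c / √(A - (A - k ^ 2) * c ^ 2)
  have hderiv : ∀ c ∈ Set.Icc (-1 : ℝ) 1,
      HasDerivAt g (k * A / (√(A - (A - k ^ 2) * c ^ 2)) ^ 3) c := by
    intro c hc
    have hQ := hpos c hc
    have hs := Real.sqrt_pos.2 hQ
    have hd : HasDerivAt (fun c : ℝ => A - (A - k ^ 2) * c ^ 2) (-((A - k ^ 2) * (2 * c))) c := by
      simpa using ((hasDerivAt_pow 2 c).const_mul (A - k ^ 2)).const_sub A
    refine (((hasDerivAt_id c).const_mul k).div (hd.sqrt hQ.ne') hs.ne').congr_deriv ?_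
    have hsq := Real.sq_sqrt hQ.le
    simp only [id]
    field_simp
    rw [hsq]
    ring
  have hcont : ContinuousOn g (Set.Icc (-1) 1) :=
    fun c hc => (hderiv c hc).continuousAt.continuousWithinAt
  have hmono : StrictMonoOn g (Set.Icc (-1) 1) := by
    refine strictMonoOn_of_deriv_pos (convex_Icc _ _) hcont fun c hc => ?_
    have hc' := interior_subset hc
    rw [(hderiv c hc').deriv]
    have := Real.sqrt_pos.2 (hpos c hc')
    positivity
  have hg1 : g 1 = 1 := by simp [g, Real.sqrt_sq hk.le, hk.ne']
  have hg2 : g (-1) = -1 := by simp [g, Real.sqrt_sq hk.le, hk.ne']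
  have himage : g '' Set.Ioo (-1) 1 = Set.Ioo (-1) 1 := by
    refine subset_antisymm ?_ ?_
    · rintro _ ⟨c, hc, rfl⟩
      have hc' := Set.Ioo_subset_Icc_self hc
      constructor
      · rw [← hg2]
        exact hmono (by simp) hc' hc.1
      · exact (hmono hc' (by simp) hc.2).trans_eq hg1
    · simpa only [hg1, hg2] using intermediate_value_Ioo (by norm_num : (-1 : ℝ) ≤ 1) hcont
  rw [intervalIntegral.integral_of_le (by norm_num), intervalIntegral.integral_of_le (by norm_num),
    integral_Ioc_eq_integral_Ioo, integral_Ioc_eq_integral_Ioo]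
  nth_rewrite 1 [← himage]
  rw [integral_image_eq_integral_abs_deriv_smul measurableSet_Ioo
    (fun c hc => (hderiv c (Set.Ioo_subset_Icc_self hc)).hasDerivWithinAt)
    (hmono.injOn.mono Set.Ioo_subset_Icc_self)]
  refine setIntegral_congr_fun measurableSet_Ioo fun c _ => ?_
  simp only [smul_eq_mul]
  rw [abs_of_nonneg (by positivity)]

/-- `D(·; φ, T)` integrates to 1 over `(-1, 1)`, i.e. it is a genuine
probability density. -/
theorem corrDensity_integral_eq_one
    (T : ℕ) (hT : 3 ≤ T) (φ : ℝ) (hφ : φ ∈ Set.Ioo (-1 : ℝ) 1) :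
    ∫ c in (-1 : ℝ)..1, corrDensity T φ c = 1 := by
  obtain ⟨h1, h2⟩ := hφ
  have hT' : (3 : ℝ) ≤ T := by exact_mod_cast hT
  obtain ⟨a, ha⟩ : ∃ a : ℝ, a = ((T : ℝ) - 2) / 2 := ⟨_, rfl⟩
  have ha0 : 0 < a := by linarith
  have hk : 0 < 1 - φ := by linarith
  have hA : 0 < 1 - φ ^ 2 := by nlinarith
  have hpt : ∀ c ∈ Set.Ioo (-1 : ℝ) 1, corrDensity T φ c =
      Real.Gamma (a + 1 / 2) / (Real.Gamma a * √Real.pi) *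
        ((1 - φ) * (1 - φ ^ 2) / (√(1 - φ ^ 2 - (1 - φ ^ 2 - (1 - φ) ^ 2) * c ^ 2)) ^ 3 *
          (1 - ((1 - φ) * c / √(1 - φ ^ 2 - (1 - φ ^ 2 - (1 - φ) ^ 2) * c ^ 2)) ^ 2) ^
            (a - 1)) := by
    rintro c ⟨hc1, hc2⟩
    have hP : 0 < 1 - c ^ 2 := by nlinarith
    obtain ⟨Q, hQ⟩ : ∃ Q, Q = 1 - φ ^ 2 - (1 - φ ^ 2 - (1 - φ) ^ 2) * c ^ 2 := ⟨_, rfl⟩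
    have hQ0 : 0 < Q := by
      have : Q = (1 - φ ^ 2) * (1 - c ^ 2) + (1 - φ) ^ 2 * c ^ 2 := by rw [hQ]; ring
      rw [this]
      positivity
    have hbase : 1 - ((1 - φ) * c / √Q) ^ 2 = (1 - φ ^ 2) * (1 - c ^ 2) / Q := by
      rw [div_pow, Real.sq_sqrt hQ0.le]
      field_simp
      rw [hQ]
      ring
    have hQpow : Q ^ (-(a + 1 / 2)) = 1 / (√Q ^ 3 * Q ^ (a - 1)) := by
      rw [Real.rpow_neg hQ0.le, Real.sqrt_eq_rpow, ← Real.rpow_mul_natCast hQ0.le,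
        ← Real.rpow_add hQ0, show 1 / 2 * ((3 : ℕ) : ℝ) + (a - 1) = a + 1 / 2 by push_cast; ring,
        one_div (Q ^ _)]
    have hApow : (1 - φ ^ 2) ^ a = (1 - φ ^ 2) * (1 - φ ^ 2) ^ (a - 1) := by
      rw [Real.rpow_sub_one hA.ne']
      field_simp
    rw [← hQ, hbase, Real.div_rpow (by positivity) hQ0.le, Real.mul_rpow hA.le hP.le, corrDensity,
      show ((T : ℝ) - 1) / 2 = a + 1 / 2 by rw [ha]; ring,
      show ((T : ℝ) - 4) / 2 = a - 1 by rw [ha]; ring, ← ha,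
      show 1 - φ ^ 2 + 2 * c ^ 2 * φ * (φ - 1) = Q by rw [hQ]; ring, hQpow, hApow]
    field_simp
  have hsub := integral_comp_mul_div_sqrt hA hk fun u => (1 - u ^ 2) ^ (a - 1)
  rw [integral_one_sub_sq_rpow ha0] at hsub
  have hG := (Real.Gamma_pos_of_pos ha0).ne'
  have hGh := (Real.Gamma_pos_of_pos (by positivity : 0 < a + 1 / 2)).ne'
  have hpi := (Real.sqrt_pos.2 Real.pi_pos).ne'
  calc ∫ c in (-1 : ℝ)..1, corrDensity T φ c
      = Real.Gamma (a + 1 / 2) / (Real.Gamma a * √Real.pi) *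
          (Real.Gamma a * √Real.pi / Real.Gamma (a + 1 / 2)) := by
        rw [hsub, ← intervalIntegral.integral_const_mul,
          intervalIntegral.integral_of_le (by norm_num),
          intervalIntegral.integral_of_le (by norm_num), integral_Ioc_eq_integral_Ioo,
          integral_Ioc_eq_integral_Ioo]
        exact setIntegral_congr_fun measurableSet_Ioo hpt
    _ = 1 := by field_simp
end

section
/- Let T ≥ 3 be an integer. The value at the origin of the density from Theorem 1 equals D(0; φ, T) = [Γ((T−1)/2)/(Γ((T−2)/2)√π)] · √((1−φ)/(1+φ)), and the map φ ↦ D(0; φ, T) is strictly decreasing on (−1, 1); that is, for −1 < φ < φ' < 1 one has D(0; φ', T) < D(0; φ, T). -/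
open MeasureTheory

/-- At the origin the two powers of `1 - φ ^ 2` combine to `(1 - φ ^ 2) ^ (-1 / 2)`. -/
lemma corrDensity_zero_eq (T : ℕ) {φ : ℝ} (h₁ : -1 < φ) (h₂ : φ < 1) :
    corrDensity T φ 0 =
      (Real.Gamma (((T : ℝ) - 1) / 2) /
          (Real.Gamma (((T : ℝ) - 2) / 2) * Real.sqrt Real.pi)) *
        Real.sqrt ((1 - φ) / (1 + φ)) := by
  have hm : 0 < 1 - φ := by linarith
  have hp : 0 < 1 + φ := by linarith
  have hq : 0 < 1 - φ ^ 2 := by nlinarith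
  have hpow : (1 - φ ^ 2) ^ (((T : ℝ) - 2) / 2) * (1 - φ ^ 2) ^ (-(((T : ℝ) - 1) / 2)) =
      (Real.sqrt (1 - φ ^ 2))⁻¹ := by
    rw [← Real.rpow_add hq, Real.sqrt_eq_rpow, ← Real.rpow_neg hq.le]
    congr 1
    ring
  have hsqrt : (1 - φ) * (Real.sqrt (1 - φ ^ 2))⁻¹ = Real.sqrt ((1 - φ) / (1 + φ)) := by
    rw [← div_eq_mul_inv, eq_comm, Real.sqrt_eq_iff_mul_self_eq (by positivity) (by positivity),
      div_mul_div_comm, Real.mul_self_sqrt hq.le]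
    field_simp
    ring
  have hzero : 1 - φ ^ 2 + 2 * (0 : ℝ) ^ 2 * φ * (φ - 1) = 1 - φ ^ 2 := by ring
  have hone : (1 - (0 : ℝ) ^ 2) ^ (((T : ℝ) - 4) / 2) = 1 := by simp
  rw [corrDensity, hzero, hone, mul_one, mul_assoc, hpow, mul_div_right_comm, mul_assoc, hsqrt]

/-- the value of the density `D(·; φ, T)` at the origin, and its strict
monotonicity in `φ` (part of Remark 4). -/
theorem corrDensity_at_zero (T : ℕ) (hT : 3 ≤ T) :
    (∀ φ ∈ Set.Ioo (-1 : ℝ) 1,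
        corrDensity T φ 0 =
          (Real.Gamma (((T : ℝ) - 1) / 2) /
              (Real.Gamma (((T : ℝ) - 2) / 2) * Real.sqrt Real.pi)) *
            Real.sqrt ((1 - φ) / (1 + φ))) ∧
      (∀ φ φ' : ℝ, -1 < φ → φ < φ' → φ' < 1 →
        corrDensity T φ' 0 < corrDensity T φ 0) := by
  refine ⟨fun φ hφ => corrDensity_zero_eq T hφ.1 hφ.2, fun φ φ' h₁ h h₂ => ?_⟩
  have hT' : (3 : ℝ) ≤ T := by exact_mod_cast hT
  have hΓ₁ : 0 < Real.Gamma (((T : ℝ) - 1) / 2) := Real.Gamma_pos_of_pos (by linarith)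
  have hΓ₂ : 0 < Real.Gamma (((T : ℝ) - 2) / 2) := Real.Gamma_pos_of_pos (by linarith)
  have hp : 0 < 1 + φ := by linarith
  have hp' : 0 < 1 + φ' := by linarith
  have hm' : 0 < 1 - φ' := by linarith
  rw [corrDensity_zero_eq T (h₁.trans h) h₂, corrDensity_zero_eq T h₁ (h.trans h₂)]
  refine mul_lt_mul_of_pos_left (Real.sqrt_lt_sqrt (by positivity) ?_) (by positivity)
  rw [div_lt_div_iff₀ hp' hp]
  nlinarith
end

section
/- Let T ≥ 3 be an integer, let 0 ≤ φ < φ' < 1, and let 0 ≤ c₁ < c₂ < 1. Then D(c₂; φ', T) · D(c₁; φ, T) > D(c₁; φ', T) · D(c₂; φ, T); that is, the likelihood ratio c ↦ D(c; φ', T)/D(c; φ, T) is strictly increasing in c on [0, 1). -/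
open MeasureTheory

/-- The base of the last factor of `corrDensity` is positive. -/
theorem corrDensity_base_pos {φ c : ℝ} (hφ0 : 0 ≤ φ) (hφ1 : φ < 1) (hc : c ^ 2 < 1) :
    0 < 1 - φ ^ 2 + 2 * c ^ 2 * φ * (φ - 1) := by
  have h : 0 < (1 - φ) * (1 - φ + 2 * φ * (1 - c ^ 2)) :=
    mul_pos (by linarith)
      (add_pos_of_pos_of_nonneg (by linarith) (mul_nonneg (by linarith) (by linarith)))
  linarith

/-- The base of the last factor of `corrDensity` is strictly reverse totally positive in
`(φ, c ^ 2)`. -/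
theorem corrDensity_base_mul_lt {φ φ' c₁ c₂ : ℝ} (hφφ' : φ < φ') (hφ'1 : φ' < 1)
    (hc : c₁ ^ 2 < c₂ ^ 2) :
    (1 - φ' ^ 2 + 2 * c₂ ^ 2 * φ' * (φ' - 1)) * (1 - φ ^ 2 + 2 * c₁ ^ 2 * φ * (φ - 1)) <
      (1 - φ' ^ 2 + 2 * c₁ ^ 2 * φ' * (φ' - 1)) * (1 - φ ^ 2 + 2 * c₂ ^ 2 * φ * (φ - 1)) := by
  have h : 0 < 2 * ((1 - φ) * (1 - φ')) * ((c₂ ^ 2 - c₁ ^ 2) * (φ' - φ)) :=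
    mul_pos (mul_pos two_pos (mul_pos (by linarith) (by linarith)))
      (mul_pos (by linarith) (by linarith))
  linarith

/-- part of Remark 4: the likelihood ratio `c ↦ D(c; φ', T)/D(c; φ, T)` is
strictly increasing in `c` on `[0, 1)` when `0 ≤ φ < φ' < 1`. -/
theorem corrDensity_monotone_likelihood_ratio
    (T : ℕ) (hT : 3 ≤ T)
    (φ φ' : ℝ) (hφ0 : 0 ≤ φ) (hφφ' : φ < φ') (hφ'1 : φ' < 1)
    (c₁ c₂ : ℝ) (hc₁0 : 0 ≤ c₁) (hc₁₂ : c₁ < c₂) (hc₂1 : c₂ < 1) :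
    corrDensity T φ' c₂ * corrDensity T φ c₁ >
      corrDensity T φ' c₁ * corrDensity T φ c₂ := by
  have hT' : (3 : ℝ) ≤ T := by exact_mod_cast hT
  have hc : c₁ ^ 2 < c₂ ^ 2 := by gcongr
  have hc₂ : c₂ ^ 2 < 1 := by nlinarith
  have hφ'0 : 0 ≤ φ' := by linarith
  have hφ1 : φ < 1 := by linarith
  have hpow := Real.rpow_lt_rpow_of_neg
    (mul_pos (corrDensity_base_pos hφ'0 hφ'1 hc₂) (corrDensity_base_pos hφ0 hφ1 (hc.trans hc₂)))
    (corrDensity_base_mul_lt hφφ' hφ'1 hc)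
    (show -(((T : ℝ) - 1) / 2) < 0 by linarith)
  rw [Real.mul_rpow (corrDensity_base_pos hφ'0 hφ'1 (hc.trans hc₂)).le
      (corrDensity_base_pos hφ0 hφ1 hc₂).le,
    Real.mul_rpow (corrDensity_base_pos hφ'0 hφ'1 hc₂).le
      (corrDensity_base_pos hφ0 hφ1 (hc.trans hc₂)).le] at hpow
  have hconst : ∀ ψ : ℝ, ψ < 1 → 0 < Real.Gamma (((T : ℝ) - 1) / 2) * (1 - ψ) /
      (Real.Gamma (((T : ℝ) - 2) / 2) * Real.sqrt Real.pi) := fun ψ hψ =>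
    div_pos (mul_pos (Real.Gamma_pos_of_pos (by linarith)) (by linarith))
      (mul_pos (Real.Gamma_pos_of_pos (by linarith)) (Real.sqrt_pos.2 Real.pi_pos))
  have hcpow : ∀ c : ℝ, c ^ 2 < 1 → 0 < (1 - c ^ 2) ^ (((T : ℝ) - 4) / 2) := fun c h =>
    Real.rpow_pos_of_pos (by linarith) _
  have hφpow : ∀ ψ : ℝ, 0 ≤ ψ → ψ < 1 → 0 < (1 - ψ ^ 2) ^ (((T : ℝ) - 2) / 2) := fun ψ h0 h1 =>
    Real.rpow_pos_of_pos (by nlinarith) _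
  have hmul := mul_lt_mul_of_pos_left hpow
    (mul_pos (mul_pos (mul_pos (hconst φ' hφ'1) (hconst φ hφ1))
      (mul_pos (hcpow c₁ (hc.trans hc₂)) (hcpow c₂ hc₂)))
      (mul_pos (hφpow φ' hφ'0 hφ'1) (hφpow φ hφ0 hφ1)))
  unfold corrDensity
  convert hmul using 1 <;> ac_rfl
end
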